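/- Let k, n, Q be positive integers with k ≤ n and Q ≤ k/4. Let x_1,…,x_n be pairwise distinct real numbers, let Ω be a finite set with |Ω| = Q, let f : {1,…,n} → Ω be any function, and let X ⊆ {1,…,n} with |X| = k. Then there exists a collection of at least k/8 pairs (i,j) ∈ X², pairwise disjoint as two-element sets of indices, each satisfying f(i) = f(j), x_i < x_j, and |{ ℓ ∈ {1,…,n} \ X : f(ℓ) = f(i) and x_i < x_ℓ < x_j }| ≤ 8n/k. -/

import Mathlib

/-- Any finite set of labelled points contains pairs on a common level which use up all but at
most `Fintype.card Ω` of the points, such that pairs on the same level span disjoint intervals. -/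
theorem exists_separated_pairs {ι Ω : Type*} [Fintype Ω] (x : ι → ℝ)
    (hx : Function.Injective x) (f : ι → Ω) (X : Finset ι) :
    ∃ P : Finset (ι × ι), X.card ≤ 2 * P.card + Fintype.card Ω ∧
      (∀ a ∈ P, a.1 ∈ X ∧ a.2 ∈ X ∧ f a.1 = f a.2 ∧ x a.1 < x a.2) ∧
      ∀ a ∈ P, ∀ b ∈ P, a ≠ b → f a.1 = f b.1 → x a.2 < x b.1 ∨ x b.2 < x a.1 := by
  classical
  induction X using Finset.strongInduction with
  | H X ih =>
  by_cases hcard : X.card ≤ Fintype.card Ω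
  · exact ⟨∅, by simpa using hcard, by simp, by simp⟩
  have hne : ((X ×ˢ X).filter fun p => f p.1 = f p.2 ∧ x p.1 < x p.2).Nonempty := by
    obtain ⟨i, hi, j, hj, hij, hf⟩ := Finset.exists_ne_map_eq_of_card_lt_of_maps_to
      (s := X) (t := Finset.univ) (f := f) (by simpa using hcard) (by simp)
    rcases lt_or_gt_of_ne (hx.ne hij) with h | h
    · exact ⟨(i, j), by simp [*]⟩
    · exact ⟨(j, i), by simp [*]⟩
  obtain ⟨⟨i, j⟩, hp, hmin⟩ := Finset.exists_min_image _ (fun p => x p.2) hne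
  simp only [Finset.mem_filter, Finset.mem_product, and_imp, Prod.forall] at hp hmin
  obtain ⟨⟨hi, hj⟩, hf, hlt⟩ := hp
  have hij : i ≠ j := fun h => hlt.ne (congrArg x h)
  have hsep : ∀ l ∈ X, l ≠ i → l ≠ j → f l = f i → x j < x l := by
    intro l hl hli hlj hfl
    by_contra! hle
    have hlt' := lt_of_le_of_ne hle (hx.ne hlj)
    rcases lt_or_gt_of_ne (hx.ne hli) with h | h
    · exact absurd (hmin l i hl hi hfl h) (not_le.2 hlt)
    · exact absurd (hmin i l hi hl hfl.symm h) (not_le.2 hlt')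
  obtain ⟨P, hP, hmem, hdisj⟩ := ih (X \ {i, j})
    (Finset.sdiff_ssubset (by simp [Finset.insert_subset_iff, hi, hj]) (by simp))
  have hsub : ({i, j} : Finset ι) ⊆ X := by simp [Finset.insert_subset_iff, hi, hj]
  rw [Finset.card_sdiff_of_subset hsub, Finset.card_pair hij] at hP
  simp only [Finset.mem_sdiff, Finset.mem_insert, Finset.mem_singleton, not_or] at hmem
  have hnot : (i, j) ∉ P := fun h => (hmem _ h).1.2.1 rfl
  have hafter : ∀ b ∈ P, f i = f b.1 → x j < x b.1 := fun b hb h =>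
    hsep _ (hmem b hb).1.1 (hmem b hb).1.2.1 (hmem b hb).1.2.2 h.symm
  refine ⟨insert (i, j) P, ?_, ?_, ?_⟩
  · rw [Finset.card_insert_of_notMem hnot]
    omega
  · intro a ha
    rcases Finset.mem_insert.1 ha with rfl | ha
    · exact ⟨hi, hj, hf, hlt⟩
    · obtain ⟨h1, h2, h3⟩ := hmem a ha
      exact ⟨h1.1, h2.1, h3⟩
  · intro a ha b hb hab h
    rcases Finset.mem_insert.1 ha with rfl | ha <;> rcases Finset.mem_insert.1 hb with rfl | hb
    · exact absurd rfl hab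
    · exact Or.inl (hafter b hb h)
    · exact Or.inr (hafter a ha h.symm)
    · exact hdisj a ha b hb hab h

/-- Among finitely many disjoint subsets of a finite type, those with more than `c` elements
contribute at most `Fintype.card ι` to the total size. -/
theorem card_filter_mul_le_card {α ι : Type*} [Fintype ι] (P : Finset α)
    (U : α → Finset ι) (hU : (P : Set α).PairwiseDisjoint U) (c : ℝ) :
    ((P.filter fun a => c < ((U a).card : ℝ)).card : ℝ) * c ≤ Fintype.card ι := by
  classical
  set B := P.filter fun a => c < ((U a).card : ℝ)
  calc (B.card : ℝ) * c = ∑ _a ∈ B, c := by simp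
    _ ≤ ∑ a ∈ B, ((U a).card : ℝ) :=
        Finset.sum_le_sum fun a ha => (Finset.mem_filter.1 ha).2.le
    _ = ((B.biUnion U).card : ℝ) := by
        rw [Finset.card_biUnion (hU.subset (by exact_mod_cast Finset.filter_subset _ P))]
        push_cast
        rfl
    _ ≤ Fintype.card ι := by exact_mod_cast Finset.card_le_univ _


theorem stmt_17 (k n Q : ℕ) (hk : 0 < k) (hQ : 0 < Q) (hkn : k ≤ n)
    (hQk : (Q : ℝ) ≤ (k : ℝ) / 4)
    (x : Fin n → ℝ) (hx : Function.Injective x)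
    (Ω : Type) (instΩ : Fintype Ω) (hΩ : @Fintype.card Ω instΩ = Q)
    (f : Fin n → Ω) (X : Finset (Fin n)) (hX : X.card = k) :
    ∃ 𝒳 : Finset (Fin n × Fin n),
      -- at least k/8 pairs …
      (k : ℝ) / 8 ≤ (𝒳.card : ℝ) ∧
      -- … pairwise disjoint as two-element sets of indices …
      (∀ a ∈ 𝒳, ∀ b ∈ 𝒳, a ≠ b →
        a.1 ≠ b.1 ∧ a.1 ≠ b.2 ∧ a.2 ≠ b.1 ∧ a.2 ≠ b.2) ∧
      -- … each pair consisting of marked indices on the same level, increasing,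
      -- with at most 8n/k unmarked same-level points in between
      ∀ a ∈ 𝒳, a.1 ∈ X ∧ a.2 ∈ X ∧ f a.1 = f a.2 ∧ x a.1 < x a.2 ∧
        (({ℓ : Fin n | ℓ ∉ X ∧ f ℓ = f a.1 ∧ x a.1 < x ℓ ∧ x ℓ < x a.2}).ncard : ℝ)
          ≤ 8 * n / k := by
  classical
  obtain ⟨P, hP, hmem, hsep⟩ := exists_separated_pairs x hx f X
  rw [hΩ, hX] at hP
  let U : Fin n × Fin n → Finset (Fin n) := fun a =>
    Finset.univ.filter fun l => l ∉ X ∧ f l = f a.1 ∧ x a.1 < x l ∧ x l < x a.2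
  have hU : (P : Set (Fin n × Fin n)).PairwiseDisjoint U := by
    intro a ha b hb hab
    refine Finset.disjoint_left.2 fun l hla hlb => ?_
    simp only [U, Finset.mem_filter, Finset.mem_univ, true_and] at hla hlb
    obtain ⟨-, hfa, ha1, ha2⟩ := hla
    obtain ⟨-, hfb, hb1, hb2⟩ := hlb
    rcases hsep a ha b hb hab (hfa.symm.trans hfb) with h | h <;> linarith
  have hbad := card_filter_mul_le_card P U hU (8 * n / k)
  have hsplit := Finset.card_filter_add_card_filter_not (s := P)
    (fun a => (8 * n / k : ℝ) < ((U a).card : ℝ))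
  have hk' : (0 : ℝ) < k := by exact_mod_cast hk
  have hn' : (0 : ℝ) < n := by exact_mod_cast hk.trans_le hkn
  refine ⟨P.filter fun a => ¬ (8 * n / k : ℝ) < ((U a).card : ℝ), ?_, ?_, ?_⟩
  · rw [Fintype.card_fin, mul_div_assoc', div_le_iff₀ hk'] at hbad
    have hbad' : ((P.filter fun a => (8 * n / k : ℝ) < ((U a).card : ℝ)).card : ℝ) * 8 ≤ k :=
      le_of_mul_le_mul_left (by linarith) hn'
    have hP' : (k : ℝ) ≤ 2 * P.card + Q := by exact_mod_cast hP
    rw [← hsplit] at hP'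
    push_cast at hP'
    linarith
  · intro a ha b hb hab
    have ha := (Finset.mem_filter.1 ha).1
    have hb := (Finset.mem_filter.1 hb).1
    have hs := hsep a ha b hb hab
    obtain ⟨-, -, hfa, hla⟩ := hmem a ha
    obtain ⟨-, -, hfb, hlb⟩ := hmem b hb
    refine ⟨fun h => ?_, fun h => ?_, fun h => ?_, fun h => ?_⟩
    · rcases hs (by rw [h]) with h' | h' <;> linarith [congrArg x h]
    · rcases hs (by rw [h, hfb]) with h' | h' <;> linarith [congrArg x h]
    · rcases hs (by rw [hfa, h]) with h' | h' <;> linarith [congrArg x h]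
    · rcases hs (by rw [hfa, h, hfb]) with h' | h' <;> linarith [congrArg x h]
  · intro a ha
    obtain ⟨ha, hle⟩ := Finset.mem_filter.1 ha
    obtain ⟨h1, h2, h3, h4⟩ := hmem a ha
    refine ⟨h1, h2, h3, h4, ?_⟩
    rw [← Set.ncard_coe_finset] at hle
    simpa [U] using hle
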